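/- Let m, e ∈ ℝ with m > 0, let F : ℝ⁴ → ℝ⁴ be a linear map that is η-antisymmetric, let x : ℝ → ℝ⁴ be a C² curve, let ε : ℝ → ℝ satisfy ε(τ) < 1, set g_τ = (1 − ε(τ))·η and a²(τ) = η(ẍ(τ), ẍ(τ)), and assume the normalization g_τ(ẋ(τ), ẋ(τ)) = −1, the spacelike-acceleration condition a²(τ) ≥ 0, and the equation of motion m·ẍ(τ) = e·F(ẋ(τ)) − (2/3)e²·a²(τ)·ẋ(τ) for all τ. Then for all τ: (i) the Lorentz force is spacelike or zero, i.e. η(F(ẋ(τ)), F(ẋ(τ))) ≥ 0; (ii) m²·a²(τ) ≤ e²·η(F(ẋ(τ)), F(ẋ(τ))); and (iii) e²·η(F(ẋ(τ)), F(ẋ(τ))) = 0 if and only if a²(τ) = 0. -/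

import Mathlib

/-- The Minkowski bilinear form on `ℝ⁴`. -/
def eta (v w : Fin 4 → ℝ) : ℝ :=
  -(v 0 * w 0) + v 1 * w 1 + v 2 * w 2 + v 3 * w 3

/-- A vector orthogonal to a timelike vector is spacelike or zero. -/
theorem eta_self_nonneg_of_eta_eq_zero {u v : Fin 4 → ℝ} (hu : eta u u < 0)
    (huv : eta v u = 0) : 0 ≤ eta v v := by
  simp only [eta] at *
  have h0 : 0 < u 0 ^ 2 := by
    nlinarith [sq_nonneg (u 1), sq_nonneg (u 2), sq_nonneg (u 3)]
  have hcs : (v 0 * u 0) ^ 2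
      ≤ (v 1 ^ 2 + v 2 ^ 2 + v 3 ^ 2) * (u 1 ^ 2 + u 2 ^ 2 + u 3 ^ 2) := by
    have : v 0 * u 0 = v 1 * u 1 + v 2 * u 2 + v 3 * u 3 := by linarith
    rw [this]
    nlinarith [sq_nonneg (v 1 * u 2 - v 2 * u 1), sq_nonneg (v 1 * u 3 - v 3 * u 1),
      sq_nonneg (v 2 * u 3 - v 3 * u 2)]
  have hle : (v 1 ^ 2 + v 2 ^ 2 + v 3 ^ 2) * (u 1 ^ 2 + u 2 ^ 2 + u 3 ^ 2)
      ≤ (v 1 ^ 2 + v 2 ^ 2 + v 3 ^ 2) * u 0 ^ 2 :=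
    mul_le_mul_of_nonneg_left (by linarith) (by positivity)
  have : v 0 ^ 2 ≤ v 1 ^ 2 + v 2 ^ 2 + v 3 ^ 2 :=
    le_of_mul_le_mul_right (by linarith [mul_pow (v 0) (u 0) 2]) h0
  linarith

theorem eta_comm (v w : Fin 4 → ℝ) : eta v w = eta w v := by
  simp only [eta]; ring

theorem eta_smul_smul (c : ℝ) (v : Fin 4 → ℝ) : eta (c • v) (c • v) = c ^ 2 * eta v v := by
  simp only [eta, Pi.smul_apply, smul_eq_mul]; ring

theorem eta_smul_sub_smul (b c : ℝ) (v w : Fin 4 → ℝ) :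
    eta (b • v - c • w) (b • v - c • w)
      = b ^ 2 * eta v v - 2 * b * c * eta v w + c ^ 2 * eta w w := by
  simp only [eta, Pi.sub_apply, Pi.smul_apply, smul_eq_mul]; ring

/-- for a solution of the equation of motion
`m·ẍ = e·F(ẋ) - (2/3)e²·a²·ẋ` with `(1 - ε)·η(ẋ, ẋ) = -1` and `a² ≥ 0`:
(i) the Lorentz force is spacelike or zero; (ii) `m²·a² ≤ e²·η(Fẋ, Fẋ)`;
(iii) `e²·η(Fẋ, Fẋ) = 0` iff `a² = 0`. -/
theorem stmt12 (m e : ℝ) (hm : 0 < m)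
    (F : (Fin 4 → ℝ) →ₗ[ℝ] (Fin 4 → ℝ))
    (hF : ∀ v w, eta (F v) w = - eta v (F w))
    (x : ℝ → Fin 4 → ℝ) (hx : ContDiff ℝ 2 x)
    (ε : ℝ → ℝ) (hε1 : ∀ τ, ε τ < 1)
    (hnorm : ∀ τ, (1 - ε τ) * eta (deriv x τ) (deriv x τ) = -1)
    (hacc : ∀ τ, 0 ≤ eta (deriv (deriv x) τ) (deriv (deriv x) τ))
    (heom : ∀ τ, m • deriv (deriv x) τ
      = e • F (deriv x τ)
        - ((2 / 3) * e ^ 2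
            * eta (deriv (deriv x) τ) (deriv (deriv x) τ)) • deriv x τ) :
    ∀ τ, 0 ≤ eta (F (deriv x τ)) (F (deriv x τ)) ∧
      m ^ 2 * eta (deriv (deriv x) τ) (deriv (deriv x) τ)
        ≤ e ^ 2 * eta (F (deriv x τ)) (F (deriv x τ)) ∧
      (e ^ 2 * eta (F (deriv x τ)) (F (deriv x τ)) = 0 ↔
        eta (deriv (deriv x) τ) (deriv (deriv x) τ) = 0) := by
  intro τ
  have hu : eta (deriv x τ) (deriv x τ) < 0 := by
    by_contra! h
    linarith [hnorm τ, mul_nonneg (sub_nonneg.2 (hε1 τ).le) h]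
  have hFu : eta (F (deriv x τ)) (deriv x τ) = 0 := by
    linarith [hF (deriv x τ) (deriv x τ), eta_comm (F (deriv x τ)) (deriv x τ)]
  have key := congrArg (fun v => eta v v) (heom τ)
  simp only [eta_smul_smul, eta_smul_sub_smul, hFu] at key
  have ha := hacc τ
  set a := eta (deriv (deriv x) τ) (deriv (deriv x) τ)
  have hle : m ^ 2 * a ≤ e ^ 2 * eta (F (deriv x τ)) (F (deriv x τ)) := by
    linarith [mul_nonpos_of_nonneg_of_nonpos (sq_nonneg (2 / 3 * e ^ 2 * a)) hu.le]
  refine ⟨eta_self_nonneg_of_eta_eq_zero hu hFu, hle, fun h => ?_, fun h => ?_⟩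
  · rw [h] at hle
    exact le_antisymm (nonpos_of_mul_nonpos_right hle (by positivity)) ha
  · rw [h] at key
    linarith
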